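/- Let μ be an admissible probability measure on ℝ with second characteristic ψ, and let m, n be coprime positive integers. Then there exists a probability measure ν on ℝ with (ν̂(y))ⁿ = (μ̂(y))ᵐ for all y ∈ ℝ if and only if exp((m/n)ψ) is the characteristic function of some probability measure on ℝ; moreover, in that case any such ν satisfies ν̂ = exp((m/n)ψ). (For admissible μ, the algebraic divisibility set Λ^alg(μ) equals Λ(μ) ∩ ℚ.) -/

import Mathlib

open MeasureTheory

/-- The characteristic function of a measure on `ℝ`. -/
noncomputable def charFunR (μ : Measure ℝ) (y : ℝ) : ℂ :=
  ∫ x, Complex.exp (Complex.I * y * x) ∂μ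

/-- `Λ(μ)` for an admissible measure with second characteristic `ψ`:
the set of `t > 0` such that `exp (t ψ)` is a characteristic function. -/
def Lam (ψ : ℝ → ℂ) : Set ℝ :=
  {t | 0 < t ∧ ∃ ν : Measure ℝ, IsProbabilityMeasure ν ∧
    ∀ y, charFunR ν y = Complex.exp (t * ψ y)}

theorem charFunR_eq_charFun (μ : Measure ℝ) (y : ℝ) : charFunR μ y = charFun μ y := by
  simp only [charFunR, charFun_apply_real]
  congr with x
  ring_nf

theorem continuous_charFunR (μ : Measure ℝ) [IsFiniteMeasure μ] : Continuous (charFunR μ) := by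
  simpa only [← funext (charFunR_eq_charFun μ)] using continuous_charFun (μ := μ)

theorem charFunR_zero (μ : Measure ℝ) [IsProbabilityMeasure μ] : charFunR μ 0 = 1 := by
  simp [charFunR_eq_charFun]

theorem finite_setOf_pow_eq_one {K : Type*} [Field K] {n : ℕ} (hn : 0 < n) :
    {z : K | z ^ n = 1}.Finite := by
  classical
  refine (Polynomial.nthRootsFinset n (1 : K)).finite_toSet.subset fun z hz => ?_
  simpa [Polynomial.mem_nthRootsFinset hn] using hz

/-- Continuous functions on a preconnected space with equal `n`-th powers, one of them nowhere
zero, agree everywhere as soon as they agree at one point. -/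
theorem eq_of_pow_eq_of_continuous {X K : Type*} [TopologicalSpace X] [PreconnectedSpace X]
    [Field K] [TopologicalSpace K] [IsTopologicalDivisionRing K] [T1Space K]
    {f g : X → K} (hf : Continuous f) (hg : Continuous g) (hg0 : ∀ x, g x ≠ 0)
    {n : ℕ} (hn : 0 < n) (h : ∀ x, f x ^ n = g x ^ n) {a : X} (ha : f a = g a) (x : X) :
    f x = g x := by
  have hq : f x / g x = f a / g a :=
    isPreconnected_univ.constant_of_mapsTo (T := {z : K | z ^ n = 1})
      (f := fun y => f y / g y) (finite_setOf_pow_eq_one hn).isDiscrete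
      (hf.div hg hg0).continuousOn (fun y _ => by simp [div_pow, h y, hg0 y])
      (Set.mem_univ x) (Set.mem_univ a)
  rwa [ha, div_self (hg0 a), div_eq_one_iff_eq (hg0 x)] at hq

theorem Complex.exp_div_mul_pow (m : ℕ) {n : ℕ} (hn : 0 < n) (z : ℂ) :
    exp ((m : ℂ) / n * z) ^ n = exp z ^ m := by
  have : (n : ℂ) ≠ 0 := Nat.cast_ne_zero.2 hn.ne'
  rw [← exp_nat_mul, ← exp_nat_mul]
  congr 1
  field_simp

/-- For an admissible probability measure `μ` on `ℝ` with second
characteristic `ψ` and coprime positive integers `m, n`, there is a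
probability measure `ν` with `ν̂ⁿ = μ̂ᵐ` iff `exp ((m/n) ψ)` is a
characteristic function; and any such `ν` has `ν̂ = exp ((m/n) ψ)`.
(For admissible `μ`, `Λ^alg(μ) = Λ(μ) ∩ ℚ`.) -/
theorem alg_divisibility_eq_Lam (μ : Measure ℝ) [IsProbabilityMeasure μ]
    (ψ : ℝ → ℂ) (hψc : Continuous ψ) (hψ0 : ψ 0 = 0)
    (hμψ : ∀ y, charFunR μ y = Complex.exp (ψ y))
    (m n : ℕ) (hm : 0 < m) (hn : 0 < n) (hmn : Nat.Coprime m n) :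
    ((∃ ν : Measure ℝ, IsProbabilityMeasure ν ∧
        ∀ y, (charFunR ν y) ^ n = (charFunR μ y) ^ m) ↔
      (∃ ρ : Measure ℝ, IsProbabilityMeasure ρ ∧
        ∀ y, charFunR ρ y = Complex.exp (((m : ℝ) / n) * ψ y))) ∧
      ∀ ν : Measure ℝ, IsProbabilityMeasure ν →
        (∀ y, (charFunR ν y) ^ n = (charFunR μ y) ^ m) →
        ∀ y, charFunR ν y = Complex.exp (((m : ℝ) / n) * ψ y) := by
  have hpow (y : ℝ) : Complex.exp (((m : ℝ) / n) * ψ y) ^ n = charFunR μ y ^ m := by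
    rw [hμψ, Complex.ofReal_natCast, Complex.exp_div_mul_pow m hn]
  have huniq (ν : Measure ℝ) (hν : IsProbabilityMeasure ν)
      (h : ∀ y, charFunR ν y ^ n = charFunR μ y ^ m) (y : ℝ) :
      charFunR ν y = Complex.exp (((m : ℝ) / n) * ψ y) :=
    eq_of_pow_eq_of_continuous (continuous_charFunR ν) (by fun_prop)
      (fun _ => Complex.exp_ne_zero _) hn (fun x => (h x).trans (hpow x).symm)
      (a := 0) (by simp [charFunR_zero, hψ0]) y
  refine ⟨⟨fun ⟨ν, hν, h⟩ => ⟨ν, hν, huniq ν hν h⟩, fun ⟨ρ, hρ, h⟩ => ⟨ρ, hρ, fun y => ?_⟩⟩, huniq⟩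
  rw [h, hpow]
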